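/- arXiv:0711.4940 — 2 statements merged into one kernel-verified Lean document; each statement's English description precedes it below -/
import Mathlib

section
/- Let m₂ < m₁ be nonnegative integers with m₁ - m₂ even, n = m₁+m₂+1, and let 0 < a < b. Suppose f ∈ C^{n+2} on an open interval containing [a,b] with f^{(n+1)}(x) ≠ 0 for all x ∈ (a,b). Let P, Q ∈ π_n be the Hermite interpolants with P^{(j)}(a) = f^{(j)}(a) for j = 0,...,m₁, P^{(j)}(b) = f^{(j)}(b) for j = 0,...,m₂, and Q^{(j)}(a) = f^{(j)}(a) for j = 0,...,m₂, Q^{(j)}(b) = f^{(j)}(b) for j = 0,...,m₁. Then there exists a unique x₀ with a < x₀ < b such that P(x₀) = Q(x₀). -/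
open Polynomial Set Filter Topology

/-- A differentiable function with `s + 1` zeros in `[a, b]` has `s` critical points in `(a, b)`. -/
lemma exists_finset_hasDerivAt_eq_zero {a b : ℝ} {u u' : ℝ → ℝ}
    (hu : ∀ t ∈ Icc a b, HasDerivAt u (u' t) t) {s : ℕ} (S : Finset ℝ) (hS : S.card = s + 1)
    (hSab : ∀ x ∈ S, x ∈ Icc a b ∧ u x = 0) :
    ∃ T : Finset ℝ, T.card = s ∧ ∀ x ∈ T, x ∈ Ioo a b ∧ u' x = 0 := by
  have hmem (i : Fin (s + 1)) := hSab _ (S.orderEmbOfFin_mem hS i)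
  have hmono : StrictMono (S.orderEmbOfFin hS) := (S.orderEmbOfFin hS).strictMono
  generalize (⇑(S.orderEmbOfFin hS)) = e at hmem hmono
  have key (i : Fin s) : ∃ c ∈ Ioo (e i.castSucc) (e i.succ), u' c = 0 := by
    have hsub : Icc (e i.castSucc) (e i.succ) ⊆ Icc a b :=
      Icc_subset_Icc (hmem _).1.1 (hmem _).1.2
    exact exists_hasDerivAt_eq_zero (hmono Fin.castSucc_lt_succ)
      (fun t ht => (hu t (hsub ht)).continuousAt.continuousWithinAt)
      ((hmem _).2.trans (hmem _).2.symm) (fun t ht => hu t (hsub (Ioo_subset_Icc_self ht)))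
  choose z hz hz' using key
  have hzmono : StrictMono z := fun i j hij => by
    refine (hz i).2.trans_le (le_trans (hmono.monotone ?_) (hz j).1.le)
    exact Fin.le_def.2 (by simpa using Fin.lt_def.1 hij)
  refine ⟨Finset.univ.image z, ?_, ?_⟩
  · rw [Finset.card_image_of_injective _ hzmono.injective, Finset.card_fin]
  · intro x hx
    obtain ⟨i, -, rfl⟩ := Finset.mem_image.1 hx
    exact ⟨⟨(hmem _).1.1.trans_lt (hz i).1, (hz i).2.trans_le (hmem _).1.2⟩, hz' i⟩

/-- Rolle's theorem with zeros of multiplicity `p` and `q` at the endpoints and simple zeros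
inside the interval; `U j` plays the role of the `j`-th derivative. -/
lemma exists_iterate_hasDerivAt_eq_zero {a b : ℝ} (hab : a < b) (N : ℕ) :
    ∀ (U : ℕ → ℝ → ℝ) (p q : ℕ) (S : Finset ℝ),
      (∀ j < N, ∀ t ∈ Icc a b, HasDerivAt (U j) (U (j + 1) t) t) →
      (∀ j < p, U j a = 0) → (∀ j < q, U j b = 0) → (∀ x ∈ S, x ∈ Ioo a b ∧ U 0 x = 0) →
      p ≤ N → q ≤ N → p + q + S.card = N + 1 → ∃ ξ ∈ Ioo a b, U N ξ = 0 := by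
  induction N with
  | zero =>
    intro U p q S _ _ _ hS hp hq hcard
    obtain ⟨x, hx⟩ := Finset.card_pos.1 (show 0 < S.card by omega)
    exact ⟨x, hS x hx⟩
  | succ N ih =>
    intro U p q S hU hp hq hS hpN hqN hcard
    have haS : a ∉ S := fun h => lt_irrefl a (hS a h).1.1
    have hbS : b ∉ S := fun h => lt_irrefl b (hS b h).1.2
    obtain ⟨S', hS'card, hS'⟩ : ∃ S' : Finset ℝ,
        S'.card + (p - 1) + (q - 1) = N + 2 ∧ ∀ x ∈ S', x ∈ Icc a b ∧ U 0 x = 0 := by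
      have hSI : ∀ x ∈ S, x ∈ Icc a b ∧ U 0 x = 0 :=
        fun x hx => ⟨Ioo_subset_Icc_self (hS x hx).1, (hS x hx).2⟩
      have haI (h : 0 < p) : a ∈ Icc a b ∧ U 0 a = 0 := ⟨left_mem_Icc.2 hab.le, hp 0 h⟩
      have hbI (h : 0 < q) : b ∈ Icc a b ∧ U 0 b = 0 := ⟨right_mem_Icc.2 hab.le, hq 0 h⟩
      have habS : a ∉ insert b S := by simp [haS, hab.ne]
      rcases Nat.eq_zero_or_pos p with h₁ | h₁ <;> rcases Nat.eq_zero_or_pos q with h₂ | h₂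
      · exact ⟨S, by omega, hSI⟩
      · refine ⟨insert b S, by rw [Finset.card_insert_of_notMem hbS]; omega, ?_⟩
        exact Finset.forall_mem_insert _ _ _ |>.2 ⟨hbI h₂, hSI⟩
      · refine ⟨insert a S, by rw [Finset.card_insert_of_notMem haS]; omega, ?_⟩
        exact Finset.forall_mem_insert _ _ _ |>.2 ⟨haI h₁, hSI⟩
      · refine ⟨insert a (insert b S), ?_, ?_⟩
        · rw [Finset.card_insert_of_notMem habS, Finset.card_insert_of_notMem hbS]; omega
        · exact Finset.forall_mem_insert _ _ _ |>.2
            ⟨haI h₁, Finset.forall_mem_insert _ _ _ |>.2 ⟨hbI h₂, hSI⟩⟩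
    obtain ⟨T, hTcard, hT⟩ := exists_finset_hasDerivAt_eq_zero (hU 0 N.succ_pos)
      (s := S'.card - 1) S' (by omega) hS'
    exact ih (fun j => U (j + 1)) (p - 1) (q - 1) T (fun j hj => hU (j + 1) (by omega))
      (fun j hj => hp (j + 1) (by omega)) (fun j hj => hq (j + 1) (by omega)) hT
      (by omega) (by omega) (by omega)

lemma Polynomial.eval_iterate_derivative_eq_zero_of_pow_dvd {E : ℝ[X]} {a : ℝ} {p j : ℕ}
    (hE : (X - C a) ^ p ∣ E) (hj : j < p) : (derivative^[j] E).eval a = 0 := by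
  have h := pow_sub_dvd_iterate_derivative_of_pow_dvd j hE
  exact dvd_iff_isRoot.1 ((dvd_pow_self _ (by omega)).trans h)

lemma Polynomial.eval_iterate_derivative_of_natDegree_le {E : ℝ[X]} {N : ℕ}
    (hE : E.natDegree ≤ N) (x : ℝ) : (derivative^[N] E).eval x = N.factorial * E.coeff N := by
  have h : (derivative^[N] E).natDegree = 0 := by
    have := natDegree_iterate_derivative E N
    omega
  rw [eq_C_of_natDegree_eq_zero h, eval_C, coeff_iterate_derivative, zero_add,
    Nat.descFactorial_self, nsmul_eq_mul]

/-- `F j` is the `j`-th derivative of `F 0` on `[a, b]`, for `j ≤ N`. -/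
def IsDerivTower (F : ℕ → ℝ → ℝ) (N : ℕ) (a b : ℝ) : Prop :=
  ∀ j < N, ∀ t ∈ Icc a b, HasDerivAt (F j) (F (j + 1) t) t

/-- `P` agrees with `F 0` to order `p` at `a`. -/
def AgreesToOrder (F : ℕ → ℝ → ℝ) (P : ℝ[X]) (p : ℕ) (a : ℝ) : Prop :=
  ∀ j < p, F j a = (derivative^[j] P).eval a

lemma AgreesToOrder.mono {F : ℕ → ℝ → ℝ} {P : ℝ[X]} {p q : ℕ} {a : ℝ}
    (h : AgreesToOrder F P q a) (hpq : p ≤ q) : AgreesToOrder F P p a :=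
  fun j hj => h j (hj.trans_le hpq)

lemma AgreesToOrder.add_of_pow_dvd {F : ℕ → ℝ → ℝ} {P E : ℝ[X]} {p : ℕ} {a : ℝ}
    (h : AgreesToOrder F P p a) (hE : (X - C a) ^ p ∣ E) : AgreesToOrder F (P + E) p a := by
  intro j hj
  rw [h j hj, iterate_map_add, eval_add,
    eval_iterate_derivative_eq_zero_of_pow_dvd hE hj, add_zero]

section Interpolation

variable {F : ℕ → ℝ → ℝ} {N : ℕ} {a b : ℝ}

lemma IsDerivTower.exists_eq_factorial_mul_coeff (hF : IsDerivTower F N a b) (hab : a < b)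
    {E : ℝ[X]} (hE : E.natDegree ≤ N) {p q : ℕ} (hpa : AgreesToOrder F E p a)
    (hqb : AgreesToOrder F E q b) (S : Finset ℝ) (hS : ∀ x ∈ S, x ∈ Ioo a b ∧ F 0 x = E.eval x)
    (hp : p ≤ N) (hq : q ≤ N) (hcard : p + q + S.card = N + 1) :
    ∃ ξ ∈ Ioo a b, F N ξ = N.factorial * E.coeff N := by
  obtain ⟨ξ, hξ, h⟩ := exists_iterate_hasDerivAt_eq_zero hab N
    (fun j t => F j t - (derivative^[j] E).eval t) p q S
    (fun j hj t ht => by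
      rw [Function.iterate_succ_apply']
      exact (hF j hj t ht).sub (Polynomial.hasDerivAt _ _))
    (fun j hj => sub_eq_zero.2 (hpa j hj)) (fun j hj => sub_eq_zero.2 (hqb j hj))
    (fun x hx => ⟨(hS x hx).1, sub_eq_zero.2 (hS x hx).2⟩) hp hq hcard
  refine ⟨ξ, hξ, ?_⟩
  rw [← eval_iterate_derivative_of_natDegree_le hE ξ]
  exact sub_eq_zero.1 h

/-- The weight `(x - a) ^ p * (x - b) ^ q` does not vanish inside `(a, b)`. -/
lemma weight_ne_zero {x : ℝ} (hx : x ∈ Ioo a b) (p q : ℕ) : (x - a) ^ p * (x - b) ^ q ≠ 0 :=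
  mul_ne_zero (pow_ne_zero _ (sub_ne_zero.2 hx.1.ne')) (pow_ne_zero _ (sub_ne_zero.2 hx.2.ne))

/-- Sign of the Hermite interpolation error. -/
lemma IsDerivTower.exists_error_eq (hF : IsDerivTower F N a b) (hab : a < b)
    (hpos : ∀ x ∈ Ioo a b, 0 < F N x) {P : ℝ[X]} (hP : P.natDegree < N) {p q : ℕ}
    (hpa : AgreesToOrder F P p a) (hqb : AgreesToOrder F P q b) (hpq : p + q = N)
    {x : ℝ} (hx : x ∈ Ioo a b) :
    ∃ ν > 0, F 0 x - P.eval x = ν * ((x - a) ^ p * (x - b) ^ q) := by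
  have hw := weight_ne_zero hx p q
  set ν := (F 0 x - P.eval x) / ((x - a) ^ p * (x - b) ^ q) with hν
  have hmonic : ((X - C a) ^ p * (X - C b) ^ q : ℝ[X]).Monic :=
    ((monic_X_sub_C a).pow p).mul ((monic_X_sub_C b).pow q)
  have hdeg : ((X - C a) ^ p * (X - C b) ^ q : ℝ[X]).natDegree = N := by
    rw [((monic_X_sub_C a).pow p).natDegree_mul ((monic_X_sub_C b).pow q)]
    simp [hpq]
  have hcoeff := hmonic.coeff_natDegree
  rw [hdeg] at hcoeff
  obtain ⟨ξ, hξ, h⟩ := hF.exists_eq_factorial_mul_coeff hab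
    (E := P + (X - C a) ^ p * (X - C b) ^ q * C ν)
    (natDegree_add_le_of_degree_le hP.le
      ((natDegree_mul_C_le _ _).trans hdeg.le))
    (hpa.add_of_pow_dvd ((dvd_mul_right _ _).mul_right _))
    (hqb.add_of_pow_dvd ((dvd_mul_left _ _).mul_right _)) {x}
    (fun y hy => by
      obtain rfl := Finset.mem_singleton.1 hy
      refine ⟨hx, ?_⟩
      simp only [eval_add, eval_mul, eval_pow, eval_sub, eval_X, eval_C]
      rw [hν, mul_div_cancel₀ _ hw]
      ring)
    (by omega) (by omega) (by simp [hpq])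
  rw [coeff_add, coeff_eq_zero_of_natDegree_lt hP, coeff_mul_C, hcoeff, zero_add, one_mul] at h
  refine ⟨ν, ?_, (div_mul_cancel₀ _ hw).symm⟩
  have := hpos ξ hξ
  rw [h] at this
  exact pos_of_mul_pos_right this (by positivity)

/-- The interpolation error divided by a nodal weight of degree `N - 1` is strictly increasing. -/
lemma IsDerivTower.strictMonoOn_error_div (hF : IsDerivTower F N a b) (hab : a < b)
    (hpos : ∀ x ∈ Ioo a b, 0 < F N x) {P : ℝ[X]} (hP : P.natDegree < N) {p q : ℕ}
    (hpa : AgreesToOrder F P p a) (hqb : AgreesToOrder F P q b) (hpq : p + q + 1 = N) :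
    StrictMonoOn (fun x => (F 0 x - P.eval x) / ((x - a) ^ p * (x - b) ^ q)) (Ioo a b) := by
  intro x hx y hy hxy
  have hwx := weight_ne_zero hx p q
  have hwy := weight_ne_zero hy p q
  have hyx : 0 < y - x := sub_pos.2 hxy
  dsimp only
  set α := (F 0 x - P.eval x) / ((x - a) ^ p * (x - b) ^ q) with hα
  set β := (F 0 y - P.eval y) / ((y - a) ^ p * (y - b) ^ q) with hβ
  set μ := (β - α) / (y - x) with hμ
  have hmonic : ((X - C a) ^ p * (X - C b) ^ q : ℝ[X]).Monic :=
    ((monic_X_sub_C a).pow p).mul ((monic_X_sub_C b).pow q)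
  have hdeg : ((X - C a) ^ p * (X - C b) ^ q : ℝ[X]).natDegree = p + q := by
    rw [((monic_X_sub_C a).pow p).natDegree_mul ((monic_X_sub_C b).pow q)]
    simp
  have hlin : (C μ * (X - C x) + C α : ℝ[X]).natDegree ≤ 1 := by compute_degree
  have hcoeff : ((X - C a) ^ p * (X - C b) ^ q * (C μ * (X - C x) + C α) : ℝ[X]).coeff N = μ := by
    rw [← hpq, coeff_mul_add_eq_of_natDegree_le hdeg.le hlin, ← hdeg, hmonic.coeff_natDegree]
    simp
  obtain ⟨ξ, hξ, h⟩ := hF.exists_eq_factorial_mul_coeff hab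
    (E := P + (X - C a) ^ p * (X - C b) ^ q * (C μ * (X - C x) + C α))
    (natDegree_add_le_of_degree_le hP.le
      (natDegree_mul_le.trans ((add_le_add hdeg.le hlin).trans hpq.le)))
    (hpa.add_of_pow_dvd ((dvd_mul_right _ _).mul_right _))
    (hqb.add_of_pow_dvd ((dvd_mul_left _ _).mul_right _)) {x, y}
    (fun z hz => by
      simp only [eval_add, eval_mul, eval_pow, eval_sub, eval_X, eval_C]
      rcases Finset.mem_insert.1 hz with rfl | hz
      · refine ⟨hx, ?_⟩
        rw [sub_self, mul_zero, zero_add, hα, mul_div_cancel₀ _ hwx]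
        ring
      · obtain rfl := Finset.mem_singleton.1 hz
        refine ⟨hy, ?_⟩
        rw [hμ, div_mul_cancel₀ _ hyx.ne', sub_add_cancel, hβ, mul_div_cancel₀ _ hwy]
        ring)
    (by omega) (by omega) (by rw [Finset.card_pair hxy.ne]; omega)
  rw [coeff_add, coeff_eq_zero_of_natDegree_lt hP, hcoeff, zero_add] at h
  have h0 := hpos ξ hξ
  rw [h] at h0
  have hμ0 : 0 < μ := pos_of_mul_pos_right h0 (by positivity)
  have := mul_pos hμ0 hyx
  rw [hμ, div_mul_cancel₀ _ hyx.ne'] at this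
  linarith

end Interpolation

/-- A positive decreasing function times `(b - x) ^ e` meets a positive increasing function
times `(x - a) ^ e` exactly once. -/
lemma existsUnique_crossing {a b : ℝ} (hab : a < b) {e : ℕ} (he : e ≠ 0) {G H : ℝ → ℝ}
    (hG : StrictMonoOn G (Ioo a b)) (hG0 : ∀ x ∈ Ioo a b, 0 < G x)
    (hH : StrictAntiOn H (Ioo a b)) (hH0 : ∀ x ∈ Ioo a b, 0 < H x)
    (hcont : ContinuousOn (fun x => H x * (b - x) ^ e - G x * (x - a) ^ e) (Ioo a b)) :
    ∃! x, x ∈ Ioo a b ∧ H x * (b - x) ^ e - G x * (x - a) ^ e = 0 := by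
  have hanti : StrictAntiOn (fun x => H x * (b - x) ^ e - G x * (x - a) ^ e) (Ioo a b) := by
    intro x hx y hy hxy
    have h₁ : H y * (b - y) ^ e < H x * (b - x) ^ e :=
      mul_lt_mul'' (hH hx hy hxy) (pow_lt_pow_left₀ (by linarith) (by linarith [hy.2]) he)
        (hH0 y hy).le (pow_nonneg (by linarith [hy.2]) _)
    have h₂ : G x * (x - a) ^ e < G y * (y - a) ^ e :=
      mul_lt_mul'' (hG hx hy hxy) (pow_lt_pow_left₀ (by linarith) (by linarith [hx.1]) he)
        (hG0 x hx).le (pow_nonneg (by linarith [hx.1]) _)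
    dsimp only
    linarith
  set m := (a + b) / 2 with hm
  have hmI : m ∈ Ioo a b := ⟨by linarith, by linarith⟩
  have hleft : ∃ x ∈ Ioo a b, 0 ≤ H x * (b - x) ^ e - G x * (x - a) ^ e := by
    have hlim : Tendsto (fun x => G m * (x - a) ^ e) (𝓝[>] a) (𝓝 0) := by
      have : Continuous fun x => G m * (x - a) ^ e := by fun_prop
      simpa [he] using (this.tendsto a).mono_left nhdsWithin_le_nhds
    have hc : 0 < H m * (b - m) ^ e := mul_pos (hH0 m hmI) (pow_pos (by linarith) _)
    obtain ⟨x, hxlt, hx⟩ :=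
      ((hlim.eventually_lt_const hc).and (Ioo_mem_nhdsGT hmI.1)).exists
    have hxI : x ∈ Ioo a b := ⟨hx.1, hx.2.trans hmI.2⟩
    have h₁ : H m * (b - m) ^ e ≤ H x * (b - x) ^ e :=
      mul_le_mul (hH hxI hmI hx.2).le (pow_le_pow_left₀ (by linarith) (by linarith [hx.2]) _)
        (pow_nonneg (by linarith) _) (hH0 x hxI).le
    have h₂ : G x * (x - a) ^ e ≤ G m * (x - a) ^ e :=
      mul_le_mul_of_nonneg_right (hG hxI hmI hx.2).le (pow_nonneg (by linarith [hx.1]) _)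
    exact ⟨x, hxI, by linarith⟩
  have hright : ∃ x ∈ Ioo a b, H x * (b - x) ^ e - G x * (x - a) ^ e ≤ 0 := by
    have hlim : Tendsto (fun x => H m * (b - x) ^ e) (𝓝[<] b) (𝓝 0) := by
      have : Continuous fun x => H m * (b - x) ^ e := by fun_prop
      simpa [he] using (this.tendsto b).mono_left nhdsWithin_le_nhds
    have hc : 0 < G m * (m - a) ^ e := mul_pos (hG0 m hmI) (pow_pos (by linarith) _)
    obtain ⟨x, hxlt, hx⟩ :=
      ((hlim.eventually_lt_const hc).and (Ioo_mem_nhdsLT hmI.2)).exists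
    have hxI : x ∈ Ioo a b := ⟨hmI.1.trans hx.1, hx.2⟩
    have h₁ : G m * (m - a) ^ e ≤ G x * (x - a) ^ e :=
      mul_le_mul (hG hmI hxI hx.1).le (pow_le_pow_left₀ (by linarith) (by linarith [hx.1]) _)
        (pow_nonneg (by linarith) _) (hG0 x hxI).le
    have h₂ : H x * (b - x) ^ e ≤ H m * (b - x) ^ e :=
      mul_le_mul_of_nonneg_right (hH hmI hxI hx.1).le (pow_nonneg (by linarith [hx.2]) _)
    exact ⟨x, hxI, by linarith⟩
  obtain ⟨x₁, hx₁, h₁⟩ := hleft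
  obtain ⟨x₂, hx₂, h₂⟩ := hright
  obtain ⟨x, hx, hx0⟩ := isPreconnected_Ioo.intermediate_value hx₂ hx₁ hcont ⟨h₂, h₁⟩
  exact ⟨x, ⟨hx, hx0⟩, fun y hy => hanti.injOn hy.1 hx (hy.2.trans hx0.symm)⟩

lemma IsDerivTower.existsUnique_eval_eq {F : ℕ → ℝ → ℝ} {a b : ℝ} (hab : a < b) {m l : ℕ}
    (hF : IsDerivTower F (2 * m + 2 * l + 4) a b)
    (hpos : ∀ x ∈ Ioo a b, 0 < F (2 * m + 2 * l + 4) x) {P Q : ℝ[X]}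
    (hP : P.natDegree < 2 * m + 2 * l + 4) (hQ : Q.natDegree < 2 * m + 2 * l + 4)
    (hPa : AgreesToOrder F P (m + 2 * l + 3) a) (hPb : AgreesToOrder F P (m + 1) b)
    (hQa : AgreesToOrder F Q (m + 1) a) (hQb : AgreesToOrder F Q (m + 2 * l + 3) b) :
    ∃! x, x ∈ Ioo a b ∧ P.eval x = Q.eval x := by
  have hG := hF.strictMonoOn_error_div hab hpos hP (hPa.mono (p := m + 2 * l + 2) (by omega)) hPb
    (by omega)
  have hH := hF.strictMonoOn_error_div hab hpos hQ hQa (hQb.mono (p := m + 2 * l + 2) (by omega))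
    (by omega)
  have hdiff (x : ℝ) (hx : x ∈ Ioo a b) :
      -((F 0 x - Q.eval x) / ((x - a) ^ (m + 1) * (x - b) ^ (m + 2 * l + 2))) *
          (b - x) ^ (2 * l + 1) -
        (F 0 x - P.eval x) / ((x - a) ^ (m + 2 * l + 2) * (x - b) ^ (m + 1)) *
          (x - a) ^ (2 * l + 1) =
      (P.eval x - Q.eval x) / ((x - a) ^ (m + 1) * (x - b) ^ (m + 1)) := by
    have hxa : x - a ≠ 0 := sub_ne_zero.2 hx.1.ne'
    have hxb : x - b ≠ 0 := sub_ne_zero.2 hx.2.ne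
    have hodd : (b - x) ^ (2 * l + 1) = -(x - b) ^ (2 * l + 1) := by
      rw [← neg_sub x b, Odd.neg_pow ⟨l, rfl⟩]
    rw [hodd, show m + 2 * l + 2 = (m + 1) + (2 * l + 1) by ring, pow_add _ (m + 1),
      pow_add _ (m + 1)]
    field_simp
    ring
  have hunique := existsUnique_crossing hab (e := 2 * l + 1) (by omega) hG
    (fun x hx => by
      obtain ⟨ν, hν, h⟩ := hF.exists_error_eq hab hpos hP hPa hPb (by omega) hx
      have hw := weight_ne_zero hx (m + 2 * l + 2) (m + 1)
      have : (F 0 x - P.eval x) / ((x - a) ^ (m + 2 * l + 2) * (x - b) ^ (m + 1)) =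
          ν * (x - a) := by
        rw [h, div_eq_iff hw]; ring
      rw [this]
      exact mul_pos hν (sub_pos.2 hx.1))
    hH.neg
    (fun x hx => by
      obtain ⟨ν, hν, h⟩ := hF.exists_error_eq hab hpos hQ hQa hQb (by omega) hx
      have hw := weight_ne_zero hx (m + 1) (m + 2 * l + 2)
      have : -((F 0 x - Q.eval x) / ((x - a) ^ (m + 1) * (x - b) ^ (m + 2 * l + 2))) =
          ν * (b - x) := by
        rw [h, neg_eq_iff_eq_neg, div_eq_iff hw]; ring
      exact this ▸ mul_pos hν (sub_pos.2 hx.2))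
    (ContinuousOn.congr (ContinuousOn.div (by fun_prop) (by fun_prop)
      (fun x hx => weight_ne_zero hx (m + 1) (m + 1))) hdiff)
  refine (existsUnique_congr fun x => and_congr_right fun hx => ?_).1 hunique
  refine (Eq.congr_left (hdiff x hx)).trans ?_
  rw [div_eq_zero_iff, or_iff_left (weight_ne_zero hx _ _), sub_eq_zero]

lemma Polynomial.iteratedDeriv_eval (P : ℝ[X]) (j : ℕ) :
    iteratedDeriv j (fun t => P.eval t) = fun t => (derivative^[j] P).eval t := by
  induction j with
  | zero => simp
  | succ j ih =>
    rw [iteratedDeriv_succ, ih, Function.iterate_succ_apply']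
    ext t
    exact Polynomial.deriv _

lemma ContDiffOn.hasDerivAt_iteratedDerivWithin {f : ℝ → ℝ} {s : Set ℝ} {n j : ℕ}
    (hf : ContDiffOn ℝ n f s) (hs : IsOpen s) (hj : j < n) {t : ℝ} (ht : t ∈ s) :
    HasDerivAt (iteratedDerivWithin j f s) (iteratedDerivWithin (j + 1) f s t) t := by
  have h := hf.differentiableOn_iteratedDerivWithin (by exact_mod_cast hj) hs.uniqueDiffOn
  rw [iteratedDerivWithin_succ]
  exact (h t ht).hasDerivWithinAt.hasDerivAt (hs.mem_nhds ht)

theorem stmt4 (m₁ m₂ : ℕ) (hm : m₂ < m₁) (heven : Even (m₁ - m₂))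
    (a b c d : ℝ) (ha : 0 < a) (hab : a < b) (hca : c < a) (hbd : b < d)
    (f : ℝ → ℝ) (hf : ContDiffOn ℝ (m₁ + m₂ + 3 : ℕ) f (Set.Ioo c d))
    (hf' : ∀ x ∈ Set.Ioo a b, iteratedDerivWithin (m₁ + m₂ + 2) f (Set.Ioo c d) x ≠ 0)
    (P Q : Polynomial ℝ) (hPdeg : P.natDegree ≤ m₁ + m₂ + 1) (hQdeg : Q.natDegree ≤ m₁ + m₂ + 1)
    (hPa : ∀ j ≤ m₁, iteratedDeriv j (fun t => P.eval t) a = iteratedDerivWithin j f (Set.Ioo c d) a)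
    (hPb : ∀ j ≤ m₂, iteratedDeriv j (fun t => P.eval t) b = iteratedDerivWithin j f (Set.Ioo c d) b)
    (hQa : ∀ j ≤ m₂, iteratedDeriv j (fun t => Q.eval t) a = iteratedDerivWithin j f (Set.Ioo c d) a)
    (hQb : ∀ j ≤ m₁, iteratedDeriv j (fun t => Q.eval t) b = iteratedDerivWithin j f (Set.Ioo c d) b) :
    ∃! x₀, x₀ ∈ Set.Ioo a b ∧ P.eval x₀ = Q.eval x₀ := by
  obtain ⟨l, rfl⟩ : ∃ l, m₁ = m₂ + 2 * l + 2 := by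
    obtain ⟨r, hr⟩ := heven
    exact ⟨r - 1, by omega⟩
  set F : ℕ → ℝ → ℝ := fun j => iteratedDerivWithin j f (Ioo c d)
  have hN : m₂ + 2 * l + 2 + m₂ + 2 = 2 * m₂ + 2 * l + 4 := by ring
  rw [hN] at hf'
  have hsub : Icc a b ⊆ Ioo c d := Icc_subset_Ioo hca hbd
  have hderiv (j : ℕ) (hj : j ≤ 2 * m₂ + 2 * l + 4) (t : ℝ) (ht : t ∈ Icc a b) :
      HasDerivAt (F j) (F (j + 1) t) t :=
    hf.hasDerivAt_iteratedDerivWithin isOpen_Ioo (by omega) (hsub ht)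
  have hF : IsDerivTower F (2 * m₂ + 2 * l + 4) a b := fun j hj => hderiv j hj.le
  have agrees {R : ℝ[X]} {k : ℕ} {x : ℝ} (h : ∀ j ≤ k, iteratedDeriv j (fun t => R.eval t) x =
      iteratedDerivWithin j f (Ioo c d) x) : AgreesToOrder F R (k + 1) x := fun j hj => by
    exact (h j (by omega)).symm.trans (congrFun (R.iteratedDeriv_eval j) x)
  have hcont : ContinuousOn (F (2 * m₂ + 2 * l + 4)) (Ioo a b) := fun t ht =>
    (hderiv _ le_rfl t (Ioo_subset_Icc_self ht)).continuousAt.continuousWithinAt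
  have hsign : (∀ x ∈ Ioo a b, 0 < F (2 * m₂ + 2 * l + 4) x) ∨
      (∀ x ∈ Ioo a b, F (2 * m₂ + 2 * l + 4) x < 0) := by
    by_contra! h
    obtain ⟨⟨x, hx, hx0⟩, y, hy, hy0⟩ := h
    obtain ⟨z, hz, hz0⟩ := isPreconnected_Ioo.intermediate_value hx hy hcont ⟨hx0, hy0⟩
    exact hf' z hz hz0
  rcases hsign with hpos | hneg
  · exact hF.existsUnique_eval_eq hab hpos (by omega) (by omega) (agrees hPa) (agrees hPb)
      (agrees hQa) (agrees hQb)
  · have agrees_neg {R : ℝ[X]} {k : ℕ} {x : ℝ} (h : AgreesToOrder F R k x) :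
        AgreesToOrder (fun j t => -F j t) (-R) k x := fun j hj => by
      simp only [h j hj, iterate_derivative_neg, eval_neg]
    have := IsDerivTower.existsUnique_eval_eq (F := fun j t => -F j t) (P := -P) (Q := -Q) hab
      (fun j hj t ht => (hF j hj t ht).neg) (fun x hx => neg_pos.2 (hneg x hx))
      (by rw [natDegree_neg]; omega) (by rw [natDegree_neg]; omega)
      (agrees_neg (agrees hPa)) (agrees_neg (agrees hPb)) (agrees_neg (agrees hQa))
      (agrees_neg (agrees hQb))
    simpa only [eval_neg, neg_inj] using this
end

section
/- Suppose f, g ∈ C^{n+2}(0,∞), n = m₁+m₂+1 with m₂ < m₁ nonnegative integers, f^{(n+1)} and g^{(n+1)} never vanish, and φ = f^{(n+1)}/g^{(n+1)} is strictly monotone on (0,∞). Then for all 0 < a < b, M_{f,m₁,m₂}(a,b) ≠ M_{g,m₁,m₂}(a,b); moreover, either M_{f,m₁,m₂}(a,b) < M_{g,m₁,m₂}(a,b) for all such (a,b), or M_{f,m₁,m₂}(a,b) > M_{g,m₁,m₂}(a,b) for all such (a,b). -/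
/-- `IsDD f x y z r s D` says that `D` is the value of the confluent divided difference
`f[x, y^r, z^s]` (node `y` repeated `r` times, node `z` repeated `s` times), characterized as
the leading coefficient of the Hermite interpolant of degree at most `r + s` matching `f` at
`x` and matching `f` and its derivatives up to order `r - 1` at `y` and `s - 1` at `z`. -/
def IsDD (f : ℝ → ℝ) (x y z : ℝ) (r s : ℕ) (D : ℝ) : Prop :=
  ∃ H : Polynomial ℝ, H.natDegree ≤ r + s ∧ H.coeff (r + s) = D ∧
    H.eval x = f x ∧
    (∀ j < r, iteratedDeriv j (fun t => H.eval t) y = iteratedDeriv j f y) ∧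
    (∀ j < s, iteratedDeriv j (fun t => H.eval t) z = iteratedDeriv j f z)

open Set Polynomial

/-- `F 0, F 1, …, F N` are successive derivatives of one another on `[a, b]`. -/
def IsJet (F : ℕ → ℝ → ℝ) (a b : ℝ) (N : ℕ) : Prop :=
  ∀ k < N, ∀ x ∈ Icc a b, HasDerivAt (F k) (F (k + 1) x) x

/-- The sequence of derivatives of a polynomial, as functions. -/
noncomputable def polyJet (H : ℝ[X]) (k : ℕ) (x : ℝ) : ℝ := (derivative^[k] H).eval x

/-- The divided difference `F[x, a^i, b^j]` of a jet equals `D`. -/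
def IsJetDD (F : ℕ → ℝ → ℝ) (a b x : ℝ) (i j : ℕ) (D : ℝ) : Prop :=
  ∃ H : ℝ[X], H.natDegree ≤ i + j ∧ H.coeff (i + j) = D ∧ H.eval x = F 0 x ∧
    (∀ k < i, polyJet H k a = F k a) ∧ ∀ k < j, polyJet H k b = F k b

/-! ### Rolle's theorem with multiplicities -/

lemma exists_finset_rolle {f f' : ℝ → ℝ} {a b : ℝ}
    (hd : ∀ x ∈ Icc a b, HasDerivAt f (f' x) x) (T : Finset ℝ)
    (hT : ∀ t ∈ T, t ∈ Icc a b ∧ f t = 0) :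
    ∃ Z : Finset ℝ, T.card ≤ Z.card + 1 ∧
      ∀ z ∈ Z, f' z = 0 ∧ (∃ s ∈ T, s < z) ∧ ∃ s ∈ T, z < s := by
  induction T using Finset.induction_on_max with
  | empty => exact ⟨∅, by simp⟩
  | insert m T hm ih =>
    obtain ⟨Z, hcard, hZ⟩ := ih fun t ht => hT t (Finset.mem_insert_of_mem ht)
    rcases T.eq_empty_or_nonempty with rfl | hne
    · exact ⟨∅, by simp⟩
    have hsT := T.max'_mem hne
    set s := T.max' hne
    have hs' := hT s (Finset.mem_insert_of_mem hsT)
    have hm' := hT m (Finset.mem_insert_self _ _)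
    have hsub : Icc s m ⊆ Icc a b := Icc_subset_Icc hs'.1.1 hm'.1.2
    obtain ⟨z, hz, hz0⟩ := exists_hasDerivAt_eq_zero (hm s hsT)
      (fun x hx => (hd x (hsub hx)).continuousAt.continuousWithinAt) (hs'.2.trans hm'.2.symm)
      (fun x hx => hd x (hsub (Ioo_subset_Icc_self hx)))
    have hzZ : z ∉ Z := fun h => by
      obtain ⟨u, hu, hzu⟩ := (hZ z h).2.2
      have := T.le_max' u hu
      linarith [hz.1]
    refine ⟨insert z Z, ?_, ?_⟩
    · rw [Finset.card_insert_of_notMem hzZ,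
        Finset.card_insert_of_notMem fun h => lt_irrefl _ (hm m h)]
      omega
    · intro y hy
      rcases Finset.mem_insert.1 hy with rfl | hy
      · exact ⟨hz0, ⟨s, Finset.mem_insert_of_mem hsT, hz.1⟩, m, Finset.mem_insert_self _ _, hz.2⟩
      · obtain ⟨h1, ⟨u, hu, hu'⟩, v, hv, hv'⟩ := hZ y hy
        exact ⟨h1, ⟨u, Finset.mem_insert_of_mem hu, hu'⟩, v, Finset.mem_insert_of_mem hv, hv'⟩

lemma IsJet.shift {F : ℕ → ℝ → ℝ} {a b : ℝ} {N : ℕ} (hF : IsJet F a b (N + 1)) :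
    IsJet (fun k => F (k + 1)) a b N :=
  fun k hk => hF (k + 1) (by omega)

/-- A sign at a point to the left of all zeros propagates to the highest derivative. -/
lemma exists_zero_right_of_sign {a b : ℝ} (N : ℕ) :
    ∀ (F : ℕ → ℝ → ℝ), IsJet F a b N → ∀ (j : ℕ) (Z : Finset ℝ) (y s : ℝ), a ≤ y → y < b →
      (∀ z ∈ Z, y < z ∧ z < b ∧ F 0 z = 0) → (∀ k < j, F k b = 0) → N + 1 ≤ j + Z.card →
      0 ≤ s * F 0 y →
      ∃ y' τ, a ≤ y' ∧ y' < τ ∧ τ ≤ b ∧ F N τ = 0 ∧ 0 ≤ (-1) ^ N * s * F N y' := by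
  induction N with
  | zero =>
    intro F _ j Z y s hay hyb hZ hj hcard hs
    rcases Z.eq_empty_or_nonempty with rfl | ⟨z, hz⟩
    · exact ⟨y, b, hay, hyb, le_rfl, hj 0 (by simp at hcard; omega), by simpa using hs⟩
    · exact ⟨y, z, hay, (hZ z hz).1, (hZ z hz).2.1.le, (hZ z hz).2.2, by simpa using hs⟩
  | succ N ih =>
    intro F hF j Z y s hay hyb hZ hj hcard hs
    obtain ⟨T, hTcard, hT⟩ : ∃ T : Finset ℝ, Z.card + min j 1 = T.card ∧
        ∀ t ∈ T, y < t ∧ t ≤ b ∧ F 0 t = 0 := by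
      rcases Nat.eq_zero_or_pos j with rfl | hjpos
      · exact ⟨Z, by simp, fun t ht => ⟨(hZ t ht).1, (hZ t ht).2.1.le, (hZ t ht).2.2⟩⟩
      · refine ⟨insert b Z, ?_, ?_⟩
        · rw [Finset.card_insert_of_notMem fun h => lt_irrefl _ (hZ b h).2.1]
          omega
        · intro t ht
          rcases Finset.mem_insert.1 ht with rfl | ht
          · exact ⟨hyb, le_rfl, hj 0 hjpos⟩
          · exact ⟨(hZ t ht).1, (hZ t ht).2.1.le, (hZ t ht).2.2⟩
    have hne : T.Nonempty := Finset.card_pos.1 (by omega)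
    have hmT := T.min'_mem hne
    set m := T.min' hne
    obtain ⟨hym, hmb, hm0⟩ := hT m hmT
    have hd : ∀ x ∈ Icc a b, HasDerivAt (F 0) (F 1 x) x := hF 0 (by omega)
    have hsub : Icc y m ⊆ Icc a b := Icc_subset_Icc hay hmb
    obtain ⟨c, hc, hc'⟩ := exists_hasDerivAt_eq_slope (F 0) (F 1) hym
      (fun x hx => (hd x (hsub hx)).continuousAt.continuousWithinAt)
      (fun x hx => hd x (hsub (Ioo_subset_Icc_self hx)))
    obtain ⟨Z', hZcard, hZ'⟩ := exists_finset_rolle hd T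
      fun t ht => ⟨⟨hay.trans (hT t ht).1.le, (hT t ht).2.1⟩, (hT t ht).2.2⟩
    obtain ⟨y', τ, h1, h2, h3, h4, h5⟩ := ih (fun k => F (k + 1)) hF.shift (j - 1) Z' c (-s)
      (hay.trans hc.1.le) (hc.2.trans_le hmb)
      (fun z hz => by
        obtain ⟨h0, ⟨u, hu, hu'⟩, v, hv, hv'⟩ := hZ' z hz
        have := T.min'_le u hu
        exact ⟨by linarith [hc.2], by linarith [(hT v hv).2.1], h0⟩)
      (fun k hk => hj (k + 1) (by omega)) (by omega)
      (by
        have : -s * F (0 + 1) c = s * F 0 y / (m - y) := by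
          simp only [zero_add, hc', hm0]; ring
        rw [this]
        exact div_nonneg hs (by linarith))
    refine ⟨y', τ, h1, h2, h3, h4, ?_⟩
    rw [pow_succ]
    convert h5 using 1
    ring

/-- The sign of the first free derivative at a multiple zero `a` propagates to the highest
derivative. -/
lemma exists_zero_right_of_sign_deriv {a b : ℝ} (hab : a < b) (i p : ℕ) :
    ∀ (F : ℕ → ℝ → ℝ), IsJet F a b (i + p) → ∀ (j : ℕ) (Z : Finset ℝ) (s : ℝ),
      (∀ k < i, F k a = 0) → (∀ z ∈ Z, z ∈ Ioo a b ∧ F 0 z = 0) → (∀ k < j, F k b = 0) →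
      p + 1 ≤ j + Z.card → 0 ≤ s * F i a →
      ∃ y τ, a ≤ y ∧ y < τ ∧ τ ≤ b ∧ F (i + p) τ = 0 ∧ 0 ≤ (-1) ^ p * s * F (i + p) y := by
  induction i with
  | zero =>
    intro F hF j Z s _ hZ hj hcard hs
    rw [zero_add] at hF ⊢
    exact exists_zero_right_of_sign p F hF j Z a s le_rfl hab
      (fun z hz => ⟨(hZ z hz).1.1, (hZ z hz).1.2, (hZ z hz).2⟩) hj hcard hs
  | succ i ih =>
    intro F hF j Z s hi hZ hj hcard hs
    rw [show i + 1 + p = i + p + 1 by omega] at hF ⊢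
    obtain ⟨T, hTcard, hT⟩ : ∃ T : Finset ℝ, Z.card + 1 + min j 1 = T.card ∧
        ∀ t ∈ T, t ∈ Icc a b ∧ F 0 t = 0 := by
      have haZ : a ∉ Z := fun h => lt_irrefl _ (hZ a h).1.1
      have key : ∀ t ∈ insert a Z, t ∈ Icc a b ∧ F 0 t = 0 := by
        intro t ht
        rcases Finset.mem_insert.1 ht with rfl | ht
        · exact ⟨left_mem_Icc.2 hab.le, hi 0 (by omega)⟩
        · exact ⟨Ioo_subset_Icc_self (hZ t ht).1, (hZ t ht).2⟩
      rcases Nat.eq_zero_or_pos j with rfl | hjpos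
      · exact ⟨insert a Z, by simp [haZ], key⟩
      · refine ⟨insert b (insert a Z), ?_, ?_⟩
        · have hbZ : b ∉ insert a Z := fun h => by
            rcases Finset.mem_insert.1 h with rfl | h
            · exact lt_irrefl _ hab
            · exact lt_irrefl _ (hZ b h).1.2
          rw [Finset.card_insert_of_notMem hbZ, Finset.card_insert_of_notMem haZ]
          omega
        · intro t ht
          rcases Finset.mem_insert.1 ht with rfl | ht
          · exact ⟨right_mem_Icc.2 hab.le, hj 0 hjpos⟩
          · exact key t ht
    obtain ⟨Z', hZcard, hZ'⟩ := exists_finset_rolle (hF 0 (by omega)) T hT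
    exact ih (fun k => F (k + 1)) hF.shift (j - 1) Z' s (fun k hk => hi (k + 1) (by omega))
      (fun z hz => by
        obtain ⟨h0, ⟨u, hu, hu'⟩, v, hv, hv'⟩ := hZ' z hz
        exact ⟨⟨(hT u hu).1.1.trans_lt hu', hv'.trans_le (hT v hv).1.2⟩, h0⟩)
      (fun k hk => hj (k + 1) (by omega)) (by omega) hs

lemma exists_zero_deriv {a b : ℝ} (hab : a < b) {i p : ℕ} {F : ℕ → ℝ → ℝ}
    (hF : IsJet F a b (i + p)) (j : ℕ) (Z : Finset ℝ) (hi : ∀ k < i, F k a = 0)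
    (hZ : ∀ z ∈ Z, z ∈ Ioo a b ∧ F 0 z = 0) (hj : ∀ k < j, F k b = 0)
    (hcard : p + 1 ≤ j + Z.card) : ∃ τ ∈ Icc a b, F (i + p) τ = 0 := by
  obtain ⟨y, τ, h1, h2, h3, h4, -⟩ :=
    exists_zero_right_of_sign_deriv hab i p F hF j Z 0 hi hZ hj hcard (by simp)
  exact ⟨τ, ⟨h1.trans h2.le, h3⟩, h4⟩

/-! ### Derivatives of polynomials -/

lemma polyJet_zero (H : ℝ[X]) (x : ℝ) : polyJet H 0 x = H.eval x := rfl

lemma polyJet_add (H K : ℝ[X]) (k : ℕ) (x : ℝ) :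
    polyJet (H + K) k x = polyJet H k x + polyJet K k x := by
  simp [polyJet, iterate_map_add]

lemma polyJet_C_mul (c : ℝ) (H : ℝ[X]) (k : ℕ) (x : ℝ) :
    polyJet (C c * H) k x = c * polyJet H k x := by
  simp [polyJet, iterate_derivative_C_mul]

lemma hasDerivAt_polyJet (H : ℝ[X]) (k : ℕ) (x : ℝ) :
    HasDerivAt (polyJet H k) (polyJet H (k + 1) x) x := by
  have := (derivative^[k] H).hasDerivAt x
  rwa [← Function.iterate_succ_apply' derivative k H] at this

lemma polyJet_of_natDegree_le {H : ℝ[X]} {N : ℕ} (h : H.natDegree ≤ N) (x : ℝ) :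
    polyJet H N x = N.factorial * H.coeff N := by
  have h1 : (derivative^[N] H).natDegree ≤ 0 := by
    have := natDegree_iterate_derivative H N
    omega
  rw [polyJet, eq_C_of_natDegree_le_zero h1, eval_C, coeff_iterate_derivative]
  simp [Nat.descFactorial_self]

lemma polyJet_X_sub_C_pow_mul (a : ℝ) (i k : ℕ) (q : ℝ[X]) :
    polyJet ((X - C a) ^ i * q) k a =
      k.factorial * if i ≤ k then (taylor a q).coeff (k - i) else 0 := by
  have h : derivative^[k] ((X - C a) ^ i * q) =
      k.factorial • hasseDeriv k ((X - C a) ^ i * q) := by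
    rw [← factorial_smul_hasseDeriv]; rfl
  rw [polyJet, h, eval_smul, ← taylor_coeff, taylor_mul, taylor_pow, map_sub, taylor_X, taylor_C,
    add_sub_cancel_right, coeff_X_pow_mul', nsmul_eq_mul]

lemma polyJet_X_sub_C_pow_mul_of_lt {a : ℝ} {i k : ℕ} (q : ℝ[X]) (h : k < i) :
    polyJet ((X - C a) ^ i * q) k a = 0 := by
  rw [polyJet_X_sub_C_pow_mul, if_neg (by omega), mul_zero]

lemma polyJet_X_sub_C_pow_mul_self (a : ℝ) (i : ℕ) (q : ℝ[X]) :
    polyJet ((X - C a) ^ i * q) i a = i.factorial * q.eval a := by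
  rw [polyJet_X_sub_C_pow_mul, if_pos le_rfl, Nat.sub_self, taylor_coeff_zero]

lemma iteratedDeriv_polynomial_eval (H : ℝ[X]) (k : ℕ) (x : ℝ) :
    iteratedDeriv k (fun t => H.eval t) x = polyJet H k x := by
  induction k generalizing x with
  | zero => simp [polyJet]
  | succ k ih =>
    rw [iteratedDeriv_succ, funext ih]
    exact (hasDerivAt_polyJet H k x).deriv

/-! ### Hermite interpolation -/

/-- One step of Newton interpolation at the node `a`. -/
lemma exists_newton_step (F : ℕ → ℝ → ℝ) {a : ℝ} {i : ℕ} {H q : ℝ[X]} (hq : q.eval a ≠ 0)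
    (hH : ∀ k < i, polyJet H k a = F k a) :
    ∃ c : ℝ, ∀ k < i + 1, polyJet (H + C c * ((X - C a) ^ i * q)) k a = F k a := by
  refine ⟨(F i a - polyJet H i a) / (i.factorial * q.eval a), fun k hk => ?_⟩
  rw [polyJet_add, polyJet_C_mul]
  rcases Nat.lt_succ_iff_lt_or_eq.1 hk with hk | rfl
  · rw [polyJet_X_sub_C_pow_mul_of_lt q hk, hH k hk]; ring
  · have : (k.factorial : ℝ) ≠ 0 := by exact_mod_cast k.factorial_ne_zero
    rw [polyJet_X_sub_C_pow_mul_self]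
    field_simp
    ring

/-- Adding a multiple of `(X - b) ^ j` does not affect the derivatives of order less than `j`
at `b`. -/
lemma polyJet_add_C_mul_of_lt {b : ℝ} {j k : ℕ} (H q : ℝ[X]) (c : ℝ) (hk : k < j) :
    polyJet (H + C c * ((X - C b) ^ j * q)) k b = polyJet H k b := by
  rw [polyJet_add, polyJet_C_mul, polyJet_X_sub_C_pow_mul_of_lt q hk]; ring

lemma degree_add_C_mul_lt {H w : ℝ[X]} {N : ℕ} (hH : H.degree < N) (hw : w.natDegree = N) (c : ℝ) :
    (H + C c * w).degree < (N + 1 : ℕ) := by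
  have h2 : (C c * w).natDegree ≤ N := (natDegree_C_mul_le c w).trans hw.le
  refine (degree_add_le _ _).trans_lt (max_lt (hH.trans (by exact_mod_cast N.lt_succ_self)) ?_)
  exact (degree_le_of_natDegree_le h2).trans_lt (by exact_mod_cast N.lt_succ_self)

lemma monic_nodePoly (a b : ℝ) (i j : ℕ) : ((X - C a) ^ i * (X - C b) ^ j).Monic :=
  ((monic_X_sub_C a).pow i).mul ((monic_X_sub_C b).pow j)

lemma natDegree_nodePoly (a b : ℝ) (i j : ℕ) :
    ((X - C a) ^ i * (X - C b) ^ j).natDegree = i + j := by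
  rw [((monic_X_sub_C a).pow i).natDegree_mul ((monic_X_sub_C b).pow j)]
  simp

lemma exists_hermite (F : ℕ → ℝ → ℝ) {a b : ℝ} (hab : a ≠ b) (i j : ℕ) :
    ∃ H : ℝ[X], H.degree < (i + j : ℕ) ∧ (∀ k < i, polyJet H k a = F k a) ∧
      ∀ k < j, polyJet H k b = F k b := by
  induction i with
  | zero =>
    induction j with
    | zero => exact ⟨0, by simp, by simp, by simp⟩
    | succ j ih =>
      obtain ⟨H, hdeg, -, hb⟩ := ih
      obtain ⟨c, hc⟩ := exists_newton_step F (q := 1) (by simp) hb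
      refine ⟨_, ?_, by simp, hc⟩
      rw [← add_assoc]
      exact degree_add_C_mul_lt hdeg (by simp) c
  | succ i ih =>
    obtain ⟨H, hdeg, ha, hb⟩ := ih
    obtain ⟨c, hc⟩ := exists_newton_step F (q := (X - C b) ^ j)
      (by simpa using pow_ne_zero j (sub_ne_zero.2 hab)) ha
    refine ⟨_, ?_, hc, fun k hk => ?_⟩
    · rw [show i + 1 + j = i + j + 1 by omega]
      exact degree_add_C_mul_lt hdeg (natDegree_nodePoly a b i j) c
    · rw [mul_comm ((X - C a) ^ i), polyJet_add_C_mul_of_lt _ _ _ hk, hb k hk]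

/-! ### Divided differences of jets -/

lemma IsJet.sub_polyJet {F : ℕ → ℝ → ℝ} {a b : ℝ} {N : ℕ} (hF : IsJet F a b N) (H : ℝ[X]) :
    IsJet (fun k x => F k x - polyJet H k x) a b N :=
  fun k hk x hx => (hF k hk x hx).sub (hasDerivAt_polyJet H k x)

lemma IsJet.sub_const_mul {F G : ℕ → ℝ → ℝ} {a b : ℝ} {N : ℕ} (hF : IsJet F a b N)
    (hG : IsJet G a b N) (c : ℝ) : IsJet (fun k x => F k x - c * G k x) a b N :=
  fun k hk x hx => (hF k hk x hx).sub ((hG k hk x hx).const_mul c)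

lemma IsJetDD.sub_const_mul {F G : ℕ → ℝ → ℝ} {a b x : ℝ} {i j : ℕ} {D E : ℝ}
    (hF : IsJetDD F a b x i j D) (hG : IsJetDD G a b x i j E) (c : ℝ) :
    IsJetDD (fun k x => F k x - c * G k x) a b x i j (D - c * E) := by
  obtain ⟨H, h1, h2, h3, h4, h5⟩ := hF
  obtain ⟨K, k1, k2, k3, k4, k5⟩ := hG
  refine ⟨H + C (-c) * K, ?_, ?_, ?_, ?_, ?_⟩
  · exact natDegree_add_le_of_degree_le h1 ((natDegree_C_mul_le _ _).trans k1)
  · rw [coeff_add, coeff_C_mul, h2, k2]; ring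
  · rw [eval_add, eval_mul, eval_C, h3, k3]; ring
  · intro k hk; rw [polyJet_add, polyJet_C_mul, h4 k hk, k4 k hk]; ring
  · intro k hk; rw [polyJet_add, polyJet_C_mul, h5 k hk, k5 k hk]; ring

lemma IsJetDD.exists_eq_deriv {F : ℕ → ℝ → ℝ} {a b x : ℝ} {i j : ℕ} {D : ℝ}
    (hD : IsJetDD F a b x i j D) (hF : IsJet F a b (i + j)) (hx : x ∈ Ioo a b) :
    ∃ ξ ∈ Icc a b, F (i + j) ξ = (i + j).factorial * D := by
  obtain ⟨H, h1, rfl, h3, h4, h5⟩ := hD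
  obtain ⟨ξ, hξ, h⟩ := exists_zero_deriv (hx.1.trans hx.2) (hF.sub_polyJet H) j {x}
    (fun k hk => by rw [h4 k hk, sub_self])
    (fun z hz => by
      obtain rfl := Finset.mem_singleton.1 hz
      exact ⟨hx, by rw [polyJet_zero, h3, sub_self]⟩)
    (fun k hk => by rw [h5 k hk, sub_self]) (by simp)
  exact ⟨ξ, hξ, by rw [← polyJet_of_natDegree_le h1 ξ]; linarith⟩

lemma IsJetDD.pos {F : ℕ → ℝ → ℝ} {a b x : ℝ} {i j N : ℕ} {D : ℝ}
    (hD : IsJetDD F a b x i j D) (hN : i + j = N) (hF : IsJet F a b N) (hx : x ∈ Ioo a b)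
    (hpos : ∀ t ∈ Icc a b, 0 < F N t) : 0 < D := by
  subst hN
  obtain ⟨ξ, hξ, h⟩ := hD.exists_eq_deriv hF hx
  exact pos_of_mul_pos_right (h ▸ hpos ξ hξ) (Nat.cast_nonneg _)

lemma IsJetDD.unique {F : ℕ → ℝ → ℝ} {a b x : ℝ} {i j : ℕ} {D E : ℝ}
    (hD : IsJetDD F a b x i j D) (hE : IsJetDD F a b x i j E) (hx : x ∈ Ioo a b) : D = E := by
  have h := hD.sub_const_mul hE 1
  simp only [one_mul, sub_self] at h
  obtain ⟨ξ, -, hξ⟩ := h.exists_eq_deriv (fun k _ y _ => hasDerivAt_const y 0) hx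
  have := (mul_eq_zero.1 hξ.symm).resolve_left (by exact_mod_cast (i + j).factorial_ne_zero)
  linarith

lemma isJetDD_of_hermite {F : ℕ → ℝ → ℝ} {a b x : ℝ} (hx : x ∈ Ioo a b) {i j : ℕ} {P : ℝ[X]}
    (hdeg : P.degree < (i + j : ℕ)) (ha : ∀ k < i, polyJet P k a = F k a)
    (hb : ∀ k < j, polyJet P k b = F k b) :
    IsJetDD F a b x i j ((F 0 x - P.eval x) / ((x - a) ^ i * (x - b) ^ j)) := by
  have hw : (x - a) ^ i * (x - b) ^ j ≠ 0 :=
    mul_ne_zero (pow_ne_zero _ (sub_ne_zero.2 hx.1.ne')) (pow_ne_zero _ (sub_ne_zero.2 hx.2.ne))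
  refine ⟨P + C ((F 0 x - P.eval x) / ((x - a) ^ i * (x - b) ^ j)) *
    ((X - C a) ^ i * (X - C b) ^ j), ?_, ?_, ?_, ?_, ?_⟩
  · exact natDegree_add_le_of_degree_le (natDegree_le_of_degree_le hdeg.le)
      ((natDegree_C_mul_le _ _).trans (natDegree_nodePoly a b i j).le)
  · have h1 : ((X - C a) ^ i * (X - C b) ^ j).coeff (i + j) = 1 := by
      simpa only [natDegree_nodePoly] using (monic_nodePoly a b i j).coeff_natDegree
    rw [coeff_add, coeff_C_mul, h1, coeff_eq_zero_of_degree_lt hdeg]; ring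
  · simp only [eval_add, eval_mul, eval_C, eval_pow, eval_sub, eval_X]
    rw [div_mul_cancel₀ _ hw, add_sub_cancel]
  · intro k hk
    rw [polyJet_add_C_mul_of_lt _ _ _ hk, ha k hk]
  · intro k hk
    rw [mul_comm ((X - C a) ^ i), polyJet_add_C_mul_of_lt _ _ _ hk, hb k hk]

lemma exists_isJetDD (F : ℕ → ℝ → ℝ) {a b x : ℝ} (hx : x ∈ Ioo a b) (i j : ℕ) :
    ∃ D, IsJetDD F a b x i j D := by
  obtain ⟨P, hdeg, ha, hb⟩ := exists_hermite F (hx.1.trans hx.2).ne i j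
  exact ⟨_, isJetDD_of_hermite hx hdeg ha hb⟩

/-- `x ↦ F[x, a^i, b^j]` is strictly increasing if the derivative of order `i + j + 1` is positive;
the two divided differences of the next order are difference quotients of this function. -/
lemma exists_strictMonoOn_secant {F : ℕ → ℝ → ℝ} {a b : ℝ} (hab : a < b) {i j : ℕ}
    (hF : IsJet F a b (i + j + 1)) (hpos : ∀ t ∈ Icc a b, 0 < F (i + j + 1) t) :
    ∃ (A B : ℝ) (S : ℝ → ℝ), StrictMonoOn S (Ioo a b) ∧ ∀ x ∈ Ioo a b,
      IsJetDD F a b x (i + 1) j ((S x - A) / (x - a)) ∧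
      IsJetDD F a b x i (j + 1) ((B - S x) / (b - x)) := by
  obtain ⟨P, hdeg, ha, hb⟩ := exists_hermite F hab.ne i j
  obtain ⟨A, hA⟩ := exists_newton_step F (q := (X - C b) ^ j)
    (by simpa using pow_ne_zero j (sub_ne_zero.2 hab.ne)) ha
  obtain ⟨B, hB⟩ := exists_newton_step F (q := (X - C a) ^ i)
    (by simpa using pow_ne_zero i (sub_ne_zero.2 hab.ne')) hb
  set w : ℝ[X] := (X - C a) ^ i * (X - C b) ^ j with hw
  have hw' : (X - C b) ^ j * (X - C a) ^ i = w := mul_comm _ _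
  have hwdeg : w.natDegree = i + j := natDegree_nodePoly a b i j
  have hwx : ∀ x, w.eval x = (x - a) ^ i * (x - b) ^ j := fun x => by simp [hw]
  have hwa : ∀ q : ℝ[X], w * q = (X - C a) ^ i * ((X - C b) ^ j * q) := fun q => by rw [hw]; ring
  have hwb : ∀ q : ℝ[X], w * q = (X - C b) ^ j * ((X - C a) ^ i * q) := fun q => by rw [hw]; ring
  have hwx0 : ∀ x ∈ Ioo a b, w.eval x ≠ 0 := fun x hx => by
    rw [hwx]
    exact mul_ne_zero (pow_ne_zero _ (sub_ne_zero.2 hx.1.ne'))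
      (pow_ne_zero _ (sub_ne_zero.2 hx.2.ne))
  rw [hw'] at hB
  refine ⟨A, B, fun x => (F 0 x - P.eval x) / w.eval x, ?_, fun x hx => ⟨?_, ?_⟩⟩
  · intro x hx y hy hxy
    obtain ⟨σ, hσ⟩ : ∃ σ, σ = (F 0 x - P.eval x) / w.eval x := ⟨_, rfl⟩
    obtain ⟨κ, hκ⟩ : ∃ κ, κ = ((F 0 y - P.eval y) / w.eval y - σ) / (y - x) := ⟨_, rfl⟩
    have hyx : y - x ≠ 0 := sub_ne_zero.2 hxy.ne'
    have hxw := hwx0 x hx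
    have hyw := hwx0 y hy
    have hQ : (w * (X - C x)).natDegree = i + j + 1 := by
      rw [(monic_nodePoly a b i j).natDegree_mul (monic_X_sub_C x), natDegree_X_sub_C, ← hw, hwdeg]
    have hQ1 : (w * (X - C x)).coeff (i + j + 1) = 1 := by
      rw [← hQ]; exact ((monic_nodePoly a b i j).mul (monic_X_sub_C x)).coeff_natDegree
    have hR := degree_add_C_mul_lt hdeg hwdeg σ
    set R := P + C σ * w with hRdef
    set H := R + C κ * (w * (X - C x)) with hHdef
    have hHdeg : H.natDegree ≤ i + (j + 1) :=
      natDegree_add_le_of_degree_le (natDegree_le_of_degree_le hR.le)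
        ((natDegree_C_mul_le _ _).trans hQ.le)
    have hHc : H.coeff (i + (j + 1)) = κ := by
      rw [← add_assoc, hHdef, coeff_add, coeff_C_mul, hQ1, coeff_eq_zero_of_degree_lt hR]; ring
    obtain ⟨τ, hτ, h0⟩ := exists_zero_deriv hab (i := i) (p := j + 1) (hF.sub_polyJet H) j {x, y}
      (fun k hk => by
        rw [hHdef, hwa, polyJet_add_C_mul_of_lt _ _ _ hk, hRdef, hw,
          polyJet_add_C_mul_of_lt _ _ _ hk, ha k hk, sub_self])
      (fun z hz => by
        rw [polyJet_zero, hHdef, hRdef]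
        simp only [eval_add, eval_mul, eval_C, eval_sub, eval_X]
        rcases Finset.mem_insert.1 hz with rfl | hz
        · refine ⟨hx, ?_⟩
          rw [hσ]; field_simp; ring
        · obtain rfl := Finset.mem_singleton.1 hz
          refine ⟨hy, ?_⟩
          rw [hκ]; field_simp; ring)
      (fun k hk => by
        rw [hHdef, hwb, polyJet_add_C_mul_of_lt _ _ _ hk, hRdef, ← hw',
          polyJet_add_C_mul_of_lt _ _ _ hk, hb k hk, sub_self])
      (by rw [Finset.card_pair hxy.ne])
    rw [polyJet_of_natDegree_le hHdeg, hHc] at h0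
    have hκpos : 0 < κ :=
      pos_of_mul_pos_right ((sub_eq_zero.1 h0) ▸ hpos τ hτ)
        (Nat.cast_nonneg (i + (j + 1)).factorial)
    have h := mul_pos hκpos (sub_pos.2 hxy)
    rw [hκ, div_mul_cancel₀ _ hyx, hσ] at h
    exact sub_pos.1 h
  · have h := isJetDD_of_hermite (F := F) hx (i := i + 1) (j := j) (P := P + C A * w)
      (by rw [show i + 1 + j = i + j + 1 by omega]; exact degree_add_C_mul_lt hdeg hwdeg A) hA
      (fun k hk => by rw [← hw', polyJet_add_C_mul_of_lt _ _ _ hk, hb k hk])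
    convert h using 1
    have h1 := hwx0 x hx
    have h2 : x - a ≠ 0 := sub_ne_zero.2 hx.1.ne'
    rw [show (x - a) ^ (i + 1) * (x - b) ^ j = (x - a) * w.eval x by rw [hwx]; ring]
    simp only [eval_add, eval_mul, eval_C]
    field_simp
    ring
  · have h := isJetDD_of_hermite (F := F) hx (i := i) (j := j + 1) (P := P + C B * w)
      (by rw [← add_assoc]; exact degree_add_C_mul_lt hdeg hwdeg B)
      (fun k hk => by rw [hw, polyJet_add_C_mul_of_lt _ _ _ hk, ha k hk]) hB
    convert h using 1
    have h1 := hwx0 x hx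
    have h2 : b - x ≠ 0 := sub_ne_zero.2 hx.2.ne'
    rw [show (x - a) ^ i * (x - b) ^ (j + 1) = -((b - x) * w.eval x) by rw [hwx]; ring]
    simp only [eval_add, eval_mul, eval_C]
    field_simp
    ring

/-- Moving one node from `b` to `a` makes the ratio of divided differences increase faster
in the free node. -/
lemma IsJetDD.mul_lt_mul_step {F : ℕ → ℝ → ℝ} {a b x y : ℝ} {i j : ℕ}
    (hF : IsJet F a b (i + j + 1)) (hpos : ∀ t ∈ Icc a b, 0 < F (i + j + 1) t)
    (hx : x ∈ Ioo a b) (hy : y ∈ Ioo a b) (hxy : x < y) {Dx Dy Ex Ey : ℝ}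
    (hDx : IsJetDD F a b x (i + 1) j Dx) (hDy : IsJetDD F a b y (i + 1) j Dy)
    (hEx : IsJetDD F a b x i (j + 1) Ex) (hEy : IsJetDD F a b y i (j + 1) Ey) :
    ((x - a) * Dx) * ((b - y) * Ey) < ((y - a) * Dy) * ((b - x) * Ex) := by
  have hEx0 := hEx.pos (N := i + j + 1) (by omega) hF hx hpos
  have hDx0 := hDx.pos (N := i + j + 1) (by omega) hF hx hpos
  obtain ⟨A, B, S, hS, h⟩ := exists_strictMonoOn_secant (hx.1.trans hx.2) hF hpos
  have hSxy := hS hx hy hxy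
  have e1 : (x - a) * Dx = S x - A := by
    rw [hDx.unique (h x hx).1 hx, mul_div_cancel₀ _ (sub_ne_zero.2 hx.1.ne')]
  have e2 : (y - a) * Dy = S y - A := by
    rw [hDy.unique (h y hy).1 hy, mul_div_cancel₀ _ (sub_ne_zero.2 hy.1.ne')]
  have e3 : (b - x) * Ex = B - S x := by
    rw [hEx.unique (h x hx).2 hx, mul_div_cancel₀ _ (sub_ne_zero.2 hx.2.ne')]
  have e4 : (b - y) * Ey = B - S y := by
    rw [hEy.unique (h y hy).2 hy, mul_div_cancel₀ _ (sub_ne_zero.2 hy.2.ne')]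
  have p1 : 0 < S x - A := e1 ▸ mul_pos (sub_pos.2 hx.1) hDx0
  have p3 : 0 < B - S x := e3 ▸ mul_pos (sub_pos.2 hx.2) hEx0
  rw [e1, e2, e3, e4]
  nlinarith [mul_pos (sub_pos.2 hSxy) (add_pos p1 p3)]

/-- Moving one node from `b` to `a` decreases the mean value of an increasing ratio of highest
derivatives. -/
lemma IsJetDD.cross_lt_step {F G : ℕ → ℝ → ℝ} {a b x : ℝ} {i j : ℕ}
    (hF : IsJet F a b (i + j + 1)) (hG : IsJet G a b (i + j + 1))
    (hpos : ∀ t ∈ Icc a b, 0 < G (i + j + 1) t)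
    (hmono : StrictMonoOn (fun t => F (i + j + 1) t / G (i + j + 1) t) (Icc a b))
    (hx : x ∈ Ioo a b) {D₁ D₀ E₁ E₀ : ℝ}
    (hD₁ : IsJetDD F a b x (i + 1) j D₁) (hD₀ : IsJetDD F a b x i (j + 1) D₀)
    (hE₁ : IsJetDD G a b x (i + 1) j E₁) (hE₀ : IsJetDD G a b x i (j + 1) E₀) :
    D₁ * E₀ < D₀ * E₁ := by
  have hab := hx.1.trans hx.2
  have hE₀pos := hE₀.pos (N := i + j + 1) (by omega) hG hx hpos
  obtain ⟨ψ, hψ⟩ : ∃ ψ, ψ = D₀ / E₀ := ⟨_, rfl⟩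
  have hzero : D₀ - ψ * E₀ = 0 := by rw [hψ, div_mul_cancel₀ _ hE₀pos.ne', sub_self]
  have hh₁ := hD₁.sub_const_mul hE₁ ψ
  have hh₀ := hD₀.sub_const_mul hE₀ ψ
  have hjet := hF.sub_const_mul hG ψ
  rw [hzero] at hh₀
  set h : ℕ → ℝ → ℝ := fun k x => F k x - ψ * G k x
  obtain ⟨H, hdeg, hcoef, hHx, hHa, hHb⟩ := hh₀
  have hqa : ((X - C b) ^ j * (X - C x)).eval a = (a - b) ^ j * (a - x) := by simp
  obtain ⟨c, hc⟩ := exists_newton_step h (q := (X - C b) ^ j * (X - C x))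
    (by rw [hqa]; exact mul_ne_zero (pow_ne_zero _ (sub_ne_zero.2 hab.ne))
          (sub_ne_zero.2 hx.1.ne)) hHa
  have hcD : IsJetDD h a b x (i + 1) j c := by
    have hm : ((X - C a) ^ i * ((X - C b) ^ j * (X - C x))).Monic := by
      rw [← mul_assoc]; exact (monic_nodePoly a b i j).mul (monic_X_sub_C x)
    have hd : ((X - C a) ^ i * ((X - C b) ^ j * (X - C x))).natDegree = i + 1 + j := by
      rw [← mul_assoc, (monic_nodePoly a b i j).natDegree_mul (monic_X_sub_C x),
        natDegree_nodePoly, natDegree_X_sub_C]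
      omega
    refine ⟨_, ?_, ?_, ?_, hc, ?_⟩
    · exact natDegree_add_le_of_degree_le (by omega) ((natDegree_C_mul_le _ _).trans hd.le)
    · rw [coeff_add, coeff_C_mul, show i + 1 + j = i + (j + 1) by omega, hcoef,
        show i + (j + 1) = i + 1 + j by omega, ← hd, hm.coeff_natDegree]
      ring
    · simp [hHx]
    · intro k hk
      rw [mul_left_comm ((X - C a) ^ i), polyJet_add_C_mul_of_lt _ _ _ hk, hHb k (by omega)]
  have hc1 := hh₁.unique hcD hx
  have hneg : c < 0 := by
    by_contra! hc0
    have hEi : h i a - polyJet H i a = c * (i.factorial * ((a - b) ^ j * (a - x))) := by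
      rw [← hc i (by omega), polyJet_add, polyJet_C_mul, polyJet_X_sub_C_pow_mul_self, hqa]; ring
    obtain ⟨y, τ, hay, hyτ, hτb, h0, hsign⟩ := exists_zero_right_of_sign_deriv hab i (j + 1)
      (fun k x => h k x - polyJet H k x) (hjet.sub_polyJet H) (j + 1) {x} ((-1) ^ (j + 1))
      (fun k hk => by rw [hHa k hk, sub_self])
      (fun z hz => by
        obtain rfl := Finset.mem_singleton.1 hz
        exact ⟨hx, by rw [polyJet_zero, hHx, sub_self]⟩)
      (fun k hk => by rw [hHb k hk, sub_self]) (by simp)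
      (by
        rw [hEi, show (-1 : ℝ) ^ (j + 1) * (c * (i.factorial * ((a - b) ^ j * (a - x)))) =
          c * (i.factorial * ((b - a) ^ j * (x - a))) by
            rw [show a - b = -1 * (b - a) by ring, mul_pow, pow_succ]
            have : ((-1 : ℝ) ^ j) * (-1) ^ j = 1 := by rw [← mul_pow]; simp
            linear_combination c * i.factorial * (b - a) ^ j * (x - a) * this]
        have := sub_pos.2 hab
        have := sub_pos.2 hx.1
        positivity)
    have hs : (-1 : ℝ) ^ (j + 1) * (-1) ^ (j + 1) = 1 := by rw [← mul_pow]; simp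
    rw [hs, one_mul, polyJet_of_natDegree_le hdeg, hcoef, mul_zero, sub_zero] at hsign
    rw [polyJet_of_natDegree_le hdeg, hcoef, mul_zero, sub_zero] at h0
    have hyI : y ∈ Icc a b := ⟨hay, hyτ.le.trans hτb⟩
    have hτI : τ ∈ Icc a b := ⟨hay.trans hyτ.le, hτb⟩
    have hlt := hmono hyI hτI hyτ
    have hGy := hpos y hyI
    have hGτ := hpos τ hτI
    have e1 : F (i + j + 1) τ / G (i + j + 1) τ = ψ := by
      rw [div_eq_iff hGτ.ne']
      exact sub_eq_zero.1 h0
    have e2 : ψ ≤ F (i + j + 1) y / G (i + j + 1) y := by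
      rw [le_div_iff₀ hGy]
      exact sub_nonneg.1 hsign
    simp only at hlt
    linarith
  rw [← hc1, hψ] at hneg
  have := mul_neg_of_neg_of_pos hneg hE₀pos
  have e : (D₁ - D₀ / E₀ * E₁) * E₀ = D₁ * E₀ - D₀ * E₁ := by field_simp
  linarith

lemma IsJetDD.mul_lt_mul {F : ℕ → ℝ → ℝ} {a b x y : ℝ} {N i : ℕ} (hF : IsJet F a b N)
    (hpos : ∀ t ∈ Icc a b, 0 < F N t) (hx : x ∈ Ioo a b) (hy : y ∈ Ioo a b) (hxy : x < y)
    (k : ℕ) : ∀ (j : ℕ) (Dx Dy Ex Ey : ℝ), i + (k + 1) + j = N →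
      IsJetDD F a b x (i + (k + 1)) j Dx → IsJetDD F a b y (i + (k + 1)) j Dy →
      IsJetDD F a b x i (j + (k + 1)) Ex → IsJetDD F a b y i (j + (k + 1)) Ey →
      ((x - a) ^ (k + 1) * Dx) * ((b - y) ^ (k + 1) * Ey) <
        ((y - a) ^ (k + 1) * Dy) * ((b - x) ^ (k + 1) * Ex) := by
  induction k with
  | zero =>
    intro j Dx Dy Ex Ey hN hDx hDy hEx hEy
    obtain rfl : N = i + j + 1 := by omega
    simpa using hDx.mul_lt_mul_step hF hpos hx hy hxy hDy hEx hEy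
  | succ k ih =>
    intro j Dx Dy Ex Ey hN hDx hDy hEx hEy
    obtain ⟨Mx, hMx⟩ := exists_isJetDD F hx (i + (k + 1)) (j + 1)
    obtain ⟨My, hMy⟩ := exists_isJetDD F hy (i + (k + 1)) (j + 1)
    rw [show j + (k + 1 + 1) = j + 1 + (k + 1) by omega] at hEx hEy
    have h1 := ih (j + 1) Mx My Ex Ey (by omega) hMx hMy hEx hEy
    obtain rfl : N = i + (k + 1) + j + 1 := by omega
    have h2 := IsJetDD.mul_lt_mul_step hF hpos hx hy hxy hDx hDy hMx hMy
    have pMx := hMx.pos (by omega) hF hx hpos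
    have pMy := hMy.pos (by omega) hF hy hpos
    have pDx := hDx.pos (by omega) hF hx hpos
    have pEy := hEy.pos (by omega) hF hy hpos
    have q1 := sub_pos.2 hx.1
    have q2 := sub_pos.2 hy.2
    have h3 := mul_lt_mul'' h1 h2 (by positivity) (by positivity)
    refine lt_of_mul_lt_mul_right ?_ (mul_pos pMx pMy).le
    convert h3 using 1 <;> ring

lemma IsJetDD.cross_lt {F G : ℕ → ℝ → ℝ} {a b x : ℝ} {N i : ℕ}
    (hF : IsJet F a b N) (hG : IsJet G a b N) (hpos : ∀ t ∈ Icc a b, 0 < G N t)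
    (hmono : StrictMonoOn (fun t => F N t / G N t) (Icc a b)) (hx : x ∈ Ioo a b) (k : ℕ) :
    ∀ (j : ℕ) (D₁ D₀ E₁ E₀ : ℝ), i + (k + 1) + j = N →
      IsJetDD F a b x (i + (k + 1)) j D₁ → IsJetDD F a b x i (j + (k + 1)) D₀ →
      IsJetDD G a b x (i + (k + 1)) j E₁ → IsJetDD G a b x i (j + (k + 1)) E₀ →
      D₁ * E₀ < D₀ * E₁ := by
  induction k with
  | zero =>
    intro j D₁ D₀ E₁ E₀ hN hD₁ hD₀ hE₁ hE₀
    obtain rfl : N = i + j + 1 := by omega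
    exact hD₁.cross_lt_step hF hG hpos hmono hx hD₀ hE₁ hE₀
  | succ k ih =>
    intro j D₁ D₀ E₁ E₀ hN hD₁ hD₀ hE₁ hE₀
    obtain ⟨D, hD⟩ := exists_isJetDD F hx (i + (k + 1)) (j + 1)
    obtain ⟨E, hE⟩ := exists_isJetDD G hx (i + (k + 1)) (j + 1)
    rw [show j + (k + 1 + 1) = j + 1 + (k + 1) by omega] at hD₀ hE₀
    have h1 := ih (j + 1) D D₀ E E₀ (by omega) hD hD₀ hE hE₀
    obtain rfl : N = i + (k + 1) + j + 1 := by omega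
    have h2 := IsJetDD.cross_lt_step hF hG hpos hmono hx hD₁ hD hE₁ hE
    have pE := hE.pos (by omega) hG hx hpos
    have pE₁ := hE₁.pos (by omega) hG hx hpos
    have pE₀ := hE₀.pos (by omega) hG hx hpos
    refine lt_of_mul_lt_mul_right ?_ pE.le
    linarith [mul_lt_mul_of_pos_right h1 pE₁, mul_lt_mul_of_pos_right h2 pE₀]

/-- Comparison of the means of two jets with positive highest derivatives whose ratio is
increasing. -/
lemma mean_lt_mean {F G : ℕ → ℝ → ℝ} {a b x y : ℝ} {m₁ m₂ : ℕ} (hm : m₂ < m₁)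
    (hF : IsJet F a b (m₁ + m₂ + 2)) (hG : IsJet G a b (m₁ + m₂ + 2))
    (hFpos : ∀ t ∈ Icc a b, 0 < F (m₁ + m₂ + 2) t) (hGpos : ∀ t ∈ Icc a b, 0 < G (m₁ + m₂ + 2) t)
    (hmono : StrictMonoOn (fun t => F (m₁ + m₂ + 2) t / G (m₁ + m₂ + 2) t) (Icc a b))
    (hx : x ∈ Ioo a b) (hy : y ∈ Ioo a b) {D₁ D₀ E₁ E₀ : ℝ}
    (hD₁ : IsJetDD F a b y (m₁ + 1) (m₂ + 1) D₁) (hD₀ : IsJetDD F a b y (m₂ + 1) (m₁ + 1) D₀)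
    (hE₁ : IsJetDD G a b x (m₁ + 1) (m₂ + 1) E₁) (hE₀ : IsJetDD G a b x (m₂ + 1) (m₁ + 1) E₀)
    (hyeq : (y - a) ^ (m₁ - m₂) * D₁ = (b - y) ^ (m₁ - m₂) * D₀)
    (hxeq : (x - a) ^ (m₁ - m₂) * E₁ = (b - x) ^ (m₁ - m₂) * E₀) : x < y := by
  obtain ⟨k, rfl⟩ : ∃ k, m₁ = m₂ + (k + 1) := ⟨m₁ - m₂ - 1, by omega⟩
  rw [Nat.add_sub_cancel_left] at hyeq hxeq
  obtain ⟨K₁, hK₁⟩ := exists_isJetDD F hx (m₂ + (k + 1) + 1) (m₂ + 1)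
  obtain ⟨K₀, hK₀⟩ := exists_isJetDD F hx (m₂ + 1) (m₂ + (k + 1) + 1)
  have pD₁ := hD₁.pos (by omega) hF hy hFpos
  have pE₁ := hE₁.pos (by omega) hG hx hGpos
  have pE₀ := hE₀.pos (by omega) hG hx hGpos
  have q1 : 0 < (x - a) ^ (k + 1) := pow_pos (sub_pos.2 hx.1) _
  have q2 : 0 < (y - a) ^ (k + 1) := pow_pos (sub_pos.2 hy.1) _
  rw [add_right_comm m₂] at hD₁ hD₀ hE₁ hE₀ hK₁ hK₀
  have hcross := IsJetDD.cross_lt hF hG hGpos hmono hx k (m₂ + 1) _ _ _ _ (by omega)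
    hK₁ hK₀ hE₁ hE₀
  have hlt : (x - a) ^ (k + 1) * K₁ < (b - x) ^ (k + 1) * K₀ := by
    refine lt_of_mul_lt_mul_right ?_ pE₀.le
    calc (x - a) ^ (k + 1) * K₁ * E₀ = (x - a) ^ (k + 1) * (K₁ * E₀) := by ring
      _ < (x - a) ^ (k + 1) * (K₀ * E₁) := mul_lt_mul_of_pos_left hcross q1
      _ = (b - x) ^ (k + 1) * K₀ * E₀ := by linear_combination K₀ * hxeq
  by_contra! hle
  rcases hle.eq_or_lt with rfl | hyx
  · rw [hK₁.unique hD₁ hx, hK₀.unique hD₀ hx, hyeq] at hlt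
    exact lt_irrefl _ hlt
  · have h := IsJetDD.mul_lt_mul hF hFpos hy hx hyx k (m₂ + 1) _ _ _ _ (by omega)
      hD₁ hK₁ hD₀ hK₀
    rw [← hyeq] at h
    have p : 0 < (y - a) ^ (k + 1) * D₁ := mul_pos q2 pD₁
    have := mul_lt_mul_of_pos_left hlt p
    linarith

lemma IsJetDD.const_mul {F : ℕ → ℝ → ℝ} {a b x : ℝ} {i j : ℕ} {D : ℝ}
    (hF : IsJetDD F a b x i j D) (s : ℝ) :
    IsJetDD (fun k x => s * F k x) a b x i j (s * D) := by
  obtain ⟨H, h1, h2, h3, h4, h5⟩ := hF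
  refine ⟨C s * H, (natDegree_C_mul_le _ _).trans h1, by rw [coeff_C_mul, h2],
    by rw [eval_mul, eval_C, h3], ?_, ?_⟩
  · intro k hk; rw [polyJet_C_mul, h4 k hk]
  · intro k hk; rw [polyJet_C_mul, h5 k hk]

/-! ### Passage from functions to jets -/

lemma isJet_iteratedDerivWithin {f : ℝ → ℝ} {M N : ℕ} (hf : ContDiffOn ℝ M f (Ioi 0))
    (hNM : N ≤ M) {a : ℝ} (ha : 0 < a) (b : ℝ) :
    IsJet (fun k => iteratedDerivWithin k f (Ioi 0)) a b N := by
  intro k hk x hx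
  have hx0 : x ∈ Ioi (0 : ℝ) := ha.trans_le hx.1
  have hd := hf.differentiableOn_iteratedDerivWithin (m := k) (by exact_mod_cast hk.trans_le hNM)
    (uniqueDiffOn_Ioi 0)
  have h := (hd x hx0).hasDerivWithinAt.hasDerivAt (Ioi_mem_nhds hx0)
  rwa [← iteratedDerivWithin_succ] at h

lemma IsDD.isJetDD {f : ℝ → ℝ} {x a b : ℝ} {i j : ℕ} {D : ℝ} (h : IsDD f x a b i j D)
    (ha : 0 < a) (hb : 0 < b) :
    IsJetDD (fun k => iteratedDerivWithin k f (Ioi 0)) a b x i j D := by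
  obtain ⟨H, h1, h2, h3, h4, h5⟩ := h
  refine ⟨H, h1, h2, by simpa using h3, ?_, ?_⟩
  · intro k hk
    rw [← iteratedDeriv_polynomial_eval, h4 k hk]
    exact (iteratedDerivWithin_of_isOpen isOpen_Ioi ha).symm
  · intro k hk
    rw [← iteratedDeriv_polynomial_eval, h5 k hk]
    exact (iteratedDerivWithin_of_isOpen isOpen_Ioi hb).symm

lemma exists_sign_mul_pos {f : ℝ → ℝ} (hc : ContinuousOn f (Ioi 0))
    (h0 : ∀ x ∈ Ioi (0 : ℝ), f x ≠ 0) :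
    ∃ s : ℝ, (s = 1 ∨ s = -1) ∧ ∀ x ∈ Ioi (0 : ℝ), 0 < s * f x := by
  by_contra! hcon
  obtain ⟨x, hx, hfx⟩ := hcon 1 (Or.inl rfl)
  obtain ⟨y, hy, hfy⟩ := hcon (-1) (Or.inr rfl)
  obtain ⟨z, hz, hfz⟩ := isPreconnected_Ioi.intermediate_value hx hy hc
    (show (0 : ℝ) ∈ Icc (f x) (f y) from ⟨by linarith, by linarith⟩)
  exact h0 z hz hfz

theorem stmt12 (m₁ m₂ : ℕ) (hm : m₂ < m₁) (n : ℕ) (hn : n = m₁ + m₂ + 1)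
    (f g : ℝ → ℝ)
    (hf : ContDiffOn ℝ (n + 2 : ℕ) f (Set.Ioi 0)) (hg : ContDiffOn ℝ (n + 2 : ℕ) g (Set.Ioi 0))
    (hf' : ∀ x ∈ Set.Ioi (0 : ℝ), iteratedDerivWithin (n + 1) f (Set.Ioi 0) x ≠ 0)
    (hg' : ∀ x ∈ Set.Ioi (0 : ℝ), iteratedDerivWithin (n + 1) g (Set.Ioi 0) x ≠ 0)
    (hφ : StrictMonoOn
        (fun t => iteratedDerivWithin (n + 1) f (Set.Ioi 0) t /
          iteratedDerivWithin (n + 1) g (Set.Ioi 0) t) (Set.Ioi 0) ∨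
      StrictAntiOn
        (fun t => iteratedDerivWithin (n + 1) f (Set.Ioi 0) t /
          iteratedDerivWithin (n + 1) g (Set.Ioi 0) t) (Set.Ioi 0))
    (Ff Gf Fg Gg : ℝ → ℝ → ℝ → ℝ)
    (hFf : ∀ a b : ℝ, 0 < a → a < b → ∀ x ∈ Set.Ioo a b,
      IsDD f x a b (m₁ + 1) (m₂ + 1) (Ff x a b))
    (hGf : ∀ a b : ℝ, 0 < a → a < b → ∀ x ∈ Set.Ioo a b,
      IsDD f x a b (m₂ + 1) (m₁ + 1) (Gf x a b))
    (hFg : ∀ a b : ℝ, 0 < a → a < b → ∀ x ∈ Set.Ioo a b,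
      IsDD g x a b (m₁ + 1) (m₂ + 1) (Fg x a b))
    (hGg : ∀ a b : ℝ, 0 < a → a < b → ∀ x ∈ Set.Ioo a b,
      IsDD g x a b (m₂ + 1) (m₁ + 1) (Gg x a b))
    (Mf Mg : ℝ → ℝ → ℝ)
    (hMf : ∀ a b : ℝ, 0 < a → a < b → Mf a b ∈ Set.Ioo a b ∧
      (Mf a b - a) ^ (m₁ - m₂) * Ff (Mf a b) a b = (b - Mf a b) ^ (m₁ - m₂) * Gf (Mf a b) a b)
    (hMg : ∀ a b : ℝ, 0 < a → a < b → Mg a b ∈ Set.Ioo a b ∧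
      (Mg a b - a) ^ (m₁ - m₂) * Fg (Mg a b) a b = (b - Mg a b) ^ (m₁ - m₂) * Gg (Mg a b) a b) :
    (∀ a b : ℝ, 0 < a → a < b → Mf a b ≠ Mg a b) ∧
      ((∀ a b : ℝ, 0 < a → a < b → Mf a b < Mg a b) ∨
        (∀ a b : ℝ, 0 < a → a < b → Mg a b < Mf a b)) := by
  have hn1 : n + 1 = m₁ + m₂ + 2 := by omega
  rw [hn1] at hf' hg' hφ
  have hcont : ∀ u : ℝ → ℝ, ContDiffOn ℝ (n + 2 : ℕ) u (Ioi 0) →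
      ContinuousOn (iteratedDerivWithin (m₁ + m₂ + 2) u (Ioi 0)) (Ioi 0) := fun u hu =>
    hu.continuousOn_iteratedDerivWithin (by exact_mod_cast (by omega)) (uniqueDiffOn_Ioi 0)
  obtain ⟨s, hs, hspos⟩ := exists_sign_mul_pos (hcont f hf) hf'
  obtain ⟨r, hr, hrpos⟩ := exists_sign_mul_pos (hcont g hg) hg'
  have hjet : ∀ u : ℝ → ℝ, ContDiffOn ℝ (n + 2 : ℕ) u (Ioi 0) → ∀ (c a b : ℝ), 0 < a →
      IsJet (fun k x => c * iteratedDerivWithin k u (Ioi 0) x) a b (m₁ + m₂ + 2) :=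
    fun u hu c a b ha k hk x hx =>
      (isJet_iteratedDerivWithin hu (by omega) ha b k hk x hx).const_mul c
  have hIcc : ∀ a b : ℝ, 0 < a → Icc a b ⊆ Ioi 0 := fun a b ha x hx => ha.trans_le hx.1
  set F := iteratedDerivWithin (m₁ + m₂ + 2) f (Ioi 0)
  set G := iteratedDerivWithin (m₁ + m₂ + 2) g (Ioi 0)
  have hratio : StrictMonoOn (fun t => s * F t / (r * G t)) (Ioi 0) ∨
      StrictMonoOn (fun t => r * G t / (s * F t)) (Ioi 0) := by
    have hinv : StrictAntiOn (fun t => s * F t / (r * G t)) (Ioi 0) →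
        StrictMonoOn (fun t => r * G t / (s * F t)) (Ioi 0) := fun h x hx y hy hxy => by
      have := inv_strictAnti₀ (div_pos (hspos y hy) (hrpos y hy)) (h hx hy hxy)
      simpa only [inv_div] using this
    have hcase : (∀ t, s * F t / (r * G t) = F t / G t) ∨
        ∀ t, s * F t / (r * G t) = -(F t / G t) := by
      rcases hs with rfl | rfl <;> rcases hr with rfl | rfl
      · left; intro t; simp
      · right; intro t; simp [div_neg]
      · right; intro t; simp [neg_div]
      · left; intro t; simp
    rcases hcase with h | h <;> rcases hφ with hφ | hφ
    · left; simpa only [h] using hφ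
    · right; apply hinv; simpa only [h] using hφ
    · right; apply hinv; simpa only [h] using hφ.neg
    · left; simpa only [h] using hφ.neg
  have hmain : (∀ a b : ℝ, 0 < a → a < b → Mf a b < Mg a b) ∨
      (∀ a b : ℝ, 0 < a → a < b → Mg a b < Mf a b) := by
    rcases hratio with h | h
    · right
      intro a b ha hab
      have hb := ha.trans hab
      obtain ⟨hy, hyeq⟩ := hMf a b ha hab
      obtain ⟨hx, hxeq⟩ := hMg a b ha hab
      exact mean_lt_mean hm (hjet f hf s a b ha) (hjet g hg r a b ha)
        (fun t ht => hspos t (hIcc a b ha ht)) (fun t ht => hrpos t (hIcc a b ha ht))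
        (h.mono (hIcc a b ha)) hx hy
        (((hFf a b ha hab _ hy).isJetDD ha hb).const_mul s)
        (((hGf a b ha hab _ hy).isJetDD ha hb).const_mul s)
        (((hFg a b ha hab _ hx).isJetDD ha hb).const_mul r)
        (((hGg a b ha hab _ hx).isJetDD ha hb).const_mul r)
        (by linear_combination s * hyeq) (by linear_combination r * hxeq)
    · left
      intro a b ha hab
      have hb := ha.trans hab
      obtain ⟨hy, hyeq⟩ := hMf a b ha hab
      obtain ⟨hx, hxeq⟩ := hMg a b ha hab
      exact mean_lt_mean hm (hjet g hg r a b ha) (hjet f hf s a b ha)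
        (fun t ht => hrpos t (hIcc a b ha ht)) (fun t ht => hspos t (hIcc a b ha ht))
        (h.mono (hIcc a b ha)) hy hx
        (((hFg a b ha hab _ hx).isJetDD ha hb).const_mul r)
        (((hGg a b ha hab _ hx).isJetDD ha hb).const_mul r)
        (((hFf a b ha hab _ hy).isJetDD ha hb).const_mul s)
        (((hGf a b ha hab _ hy).isJetDD ha hb).const_mul s)
        (by linear_combination r * hxeq) (by linear_combination s * hyeq)
  refine ⟨fun a b ha hab => ?_, hmain⟩
  rcases hmain with h | h
  · exact (h a b ha hab).ne
  · exact (h a b ha hab).ne'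
end
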